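/- arXiv:1805.01399 — 9 statements merged into one kernel-verified Lean document; each statement's English description precedes it below -/
import Mathlib

section
/- For all Schwartz functions f, φ : ℝ → ℂ, every (y₁,y₂,y₃,y₄) ∈ 𝔾 and every (x₁,x₂,x₃) ∈ ℝ³ one has the intertwining identity [W_φ(π(y₁,y₂,y₃,y₄)f)](x₁,x₂,x₃) = exp(2πiħ(y₄ − y₁y₃ + (1/2)y₁²y₂ + y₁x₃ − (1/2)y₁²x₂)) · [W_φ f](x₁−y₁, x₂−y₂, x₃ − y₁x₂ + y₁y₂ − y₃); that is, the coherent state transform W_φ intertwines π with the induced representation on functions of (x₁,x₂,x₃). -/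
open MeasureTheory

/-- The representation π of the group 𝔾 on functions ℝ → ℂ. -/
noncomputable def rep (h₂ ℏ : ℝ) (g : ℝ × ℝ × ℝ × ℝ) (f : ℝ → ℂ) : ℝ → ℂ :=
  fun y => Complex.exp (2 * Real.pi * Complex.I *
      (h₂ * g.2.1 + ℏ * (g.2.2.2 - g.2.2.1 * y + (1/2) * g.2.1 * y^2))) * f (y - g.1)

/-- The induced coherent state transform W_φ f on 𝔾/Z ≃ ℝ³. -/
noncomputable def W (h₂ ℏ : ℝ) (φ f : ℝ → ℂ) (x : ℝ × ℝ × ℝ) : ℂ :=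
  Complex.exp (-(2 * Real.pi * Complex.I * h₂ * x.2.1)) *
    ∫ y : ℝ, f y * Complex.exp (-(2 * Real.pi * Complex.I * ℏ *
      (-(x.2.2 * y) + (1/2) * x.2.1 * y^2))) * star (φ (y - x.1))

theorem stmt3 (h₂ ℏ : ℝ) (hℏ : 0 < ℏ) (f φ : SchwartzMap ℝ ℂ)
    (g : ℝ × ℝ × ℝ × ℝ) (x : ℝ × ℝ × ℝ) :
    W h₂ ℏ φ (rep h₂ ℏ g f) x =
      Complex.exp (2 * Real.pi * Complex.I * ℏ *
          (g.2.2.2 - g.1 * g.2.2.1 + (1/2) * g.1^2 * g.2.1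
            + g.1 * x.2.2 - (1/2) * g.1^2 * x.2.1)) *
        W h₂ ℏ φ f
          (x.1 - g.1, x.2.1 - g.2.1, x.2.2 - g.1 * x.2.1 + g.1 * g.2.1 - g.2.2.1) := by
  obtain ⟨g1, g2, g3, g4⟩ := g
  obtain ⟨x1, x2, x3⟩ := x
  simp only [W, rep]
  rw [← integral_add_right_eq_self _ g1, ← integral_const_mul, ← integral_const_mul,
    ← integral_const_mul]
  congr 1
  ext u
  have e1 : u + g1 - g1 = u := by ring
  have e2 : u + g1 - x1 = u - (x1 - g1) := by ring
  rw [e1, e2]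
  generalize star (φ (u - (x1 - g1))) = p
  generalize f u = q
  have key : ∀ a b c d e k : ℂ, a + b + c = d + e + k →
      Complex.exp a * (Complex.exp b * q * Complex.exp c * p) =
      Complex.exp d * (Complex.exp e * (q * Complex.exp k * p)) := by
    intro a b c d e k h
    have h2 : Complex.exp a * Complex.exp b * Complex.exp c
        = Complex.exp d * Complex.exp e * Complex.exp k := by
      rw [← Complex.exp_add, ← Complex.exp_add, ← Complex.exp_add, ← Complex.exp_add, h]
    linear_combination q * p * h2
  apply key
  push_cast
  ring
end

section
/- For all Schwartz functions f, φ, ψ : ℝ → ℂ, every x₂ ∈ ℝ and every t ∈ ℝ, the reconstruction identity ħ ∫_ℝ ∫_ℝ [W_φ f](x₁,x₂,x₃) · exp(2πi(h₂x₂ + ħ(−x₃t + (1/2)x₂t²))) · ψ(t − x₁) dx₃ dx₁ = ⟨ψ,φ⟩_{L²(ℝ)} · f(t) holds (the x₃ integral taken first in the iterated integral); i.e. M_ψ(x₂) ∘ W_φ = ⟨ψ,φ⟩ I. -/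
open MeasureTheory

open scoped FourierTransform

lemma expI_temperate : (fun x : ℝ => Complex.exp (x * Complex.I)).HasTemperateGrowth := by
  refine ⟨((Complex.ofRealCLM.contDiff).mul contDiff_const).cexp, fun n => ⟨0, 1, fun x => ?_⟩⟩
  have h : ∀ n : ℕ, iteratedDeriv n (fun x : ℝ => Complex.exp (x * Complex.I))
      = fun x : ℝ => Complex.I ^ n * Complex.exp (x * Complex.I) := by
    intro n
    induction n with
    | zero => simp
    | succ k ih =>
      rw [iteratedDeriv_succ, ih]
      funext x
      have h1 : HasDerivAt (fun x : ℝ => (x : ℂ) * Complex.I) (1 * Complex.I) x :=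
        (Complex.ofRealCLM.hasDerivAt (x := x)).mul_const Complex.I
      rw [(h1.cexp.const_mul (Complex.I ^ k)).deriv]
      ring
  rw [norm_iteratedFDeriv_eq_norm_iteratedDeriv, h n]
  simp [Complex.norm_exp_ofReal_mul_I]

lemma exists_g (f φ : SchwartzMap ℝ ℂ) (c x₁ : ℝ) : ∃ g : SchwartzMap ℝ ℂ,
    ∀ y, g y = f y * Complex.exp (((c * y ^ 2 : ℝ) : ℂ) * Complex.I) * star (φ (y - x₁)) := by
  have h1 : (fun y : ℝ => Complex.exp (((c * y ^ 2 : ℝ) : ℂ) * Complex.I)).HasTemperateGrowth :=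
    expI_temperate.comp (f := fun y : ℝ => c * y ^ 2) (by fun_prop)
  have h2 : (fun y : ℝ => star (φ (y - x₁))).HasTemperateGrowth := by
    have := (Complex.conjCLE.hasTemperateGrowth).comp
      ((φ.compSubConstCLM ℝ x₁).hasTemperateGrowth)
    exact this
  refine ⟨SchwartzMap.smulLeftCLM ℂ (fun y : ℝ => Complex.exp (((c * y ^ 2 : ℝ) : ℂ) * Complex.I) *
    star (φ (y - x₁))) f, ?_⟩
  intro y
  rw [SchwartzMap.smulLeftCLM_apply_apply (h1.fun_mul h2)]
  simp only [smul_eq_mul]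
  ring

lemma inversion (g : SchwartzMap ℝ ℂ) (ℏ : ℝ) (hℏ : 0 < ℏ) (t : ℝ) :
    ∫ x₃ : ℝ, (∫ y : ℝ, Complex.exp (2 * Real.pi * Complex.I * ℏ * x₃ * y) * g y) *
      Complex.exp (-(2 * Real.pi * Complex.I * ℏ * x₃ * t)) = (ℏ : ℂ)⁻¹ * g t := by
  have h1 : ∀ u : ℝ, (𝓕⁻ g : SchwartzMap ℝ ℂ) u = ∫ y : ℝ, Complex.exp (2 * Real.pi * Complex.I * u * y) * g y := by
    intro u
    rw [SchwartzMap.fourierInv_coe, Real.fourierInv_eq']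
    refine integral_congr_ae (.of_forall fun y => ?_)
    simp only [smul_eq_mul]
    congr 2
    simp
    ring
  have h2 : g t = ∫ u : ℝ, (𝓕⁻ g : SchwartzMap ℝ ℂ) u * Complex.exp (-(2 * Real.pi * Complex.I * u * t)) := by
    have hh : (𝓕 (𝓕⁻ g : SchwartzMap ℝ ℂ) : SchwartzMap ℝ ℂ) = g :=
      FourierTransform.fourier_fourierInv_eq g
    conv_lhs => rw [← hh]
    rw [SchwartzMap.fourier_coe, Real.fourier_eq']
    refine integral_congr_ae (.of_forall fun y => ?_)
    simp only [smul_eq_mul]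
    rw [mul_comm]
    congr 2
    simp
    ring
  have h3 := Measure.integral_comp_mul_left
    (fun u : ℝ => (𝓕⁻ g : SchwartzMap ℝ ℂ) u * Complex.exp (-(2 * Real.pi * Complex.I * u * t))) ℏ
  rw [← h2, abs_of_pos (inv_pos.2 hℏ)] at h3
  rw [Complex.real_smul, Complex.ofReal_inv] at h3
  rw [← h3]
  refine integral_congr_ae (.of_forall fun y => ?_)
  simp only [h1]
  push_cast
  simp only [mul_assoc]

theorem stmt6 (h₂ ℏ : ℝ) (hℏ : 0 < ℏ) (f φ ψ : SchwartzMap ℝ ℂ) (x₂ t : ℝ) :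
    (ℏ : ℂ) * ∫ x₁ : ℝ, ∫ x₃ : ℝ,
        W h₂ ℏ φ f (x₁, x₂, x₃) *
          Complex.exp (2 * Real.pi * Complex.I *
            (h₂ * x₂ + ℏ * (-(x₃ * t) + (1/2) * x₂ * t^2))) * ψ (t - x₁)
      = (∫ y : ℝ, ψ y * star (φ y)) * f t := by
  have inner : ∀ x₁ : ℝ, ∫ x₃ : ℝ,
        W h₂ ℏ φ f (x₁, x₂, x₃) *
          Complex.exp (2 * Real.pi * Complex.I *
            (h₂ * x₂ + ℏ * (-(x₃ * t) + (1/2) * x₂ * t^2))) * ψ (t - x₁)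
      = (ℏ : ℂ)⁻¹ * ((ψ (t - x₁) * star (φ (t - x₁))) * f t) := by
    intro x₁
    obtain ⟨g, hg⟩ := exists_g f φ (-(Real.pi * ℏ * x₂)) x₁
    have key := inversion g ℏ hℏ t
    have e : ∀ x₃ : ℝ, W h₂ ℏ φ f (x₁, x₂, x₃) *
          Complex.exp (2 * Real.pi * Complex.I *
            (h₂ * x₂ + ℏ * (-(x₃ * t) + (1/2) * x₂ * t^2))) * ψ (t - x₁)
        = ((∫ y : ℝ, Complex.exp (2 * Real.pi * Complex.I * ℏ * x₃ * y) * g y) *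
      Complex.exp (-(2 * Real.pi * Complex.I * ℏ * x₃ * t))) *
        (Complex.exp (Real.pi * Complex.I * ℏ * x₂ * t ^ 2) * ψ (t - x₁)) := by
      intro x₃
      have e1 : ∫ y : ℝ, f y * Complex.exp (-(2 * Real.pi * Complex.I * ℏ *
          (-(x₃ * y) + (1/2) * x₂ * y^2))) * star (φ (y - x₁))
          = ∫ y : ℝ, Complex.exp (2 * Real.pi * Complex.I * ℏ * x₃ * y) * g y := by
        refine integral_congr_ae (.of_forall fun y => ?_)
        simp only [hg]
        have : Complex.exp (-(2 * Real.pi * Complex.I * ℏ *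
          (-(x₃ * y) + (1/2) * x₂ * y^2))) = Complex.exp (2 * Real.pi * Complex.I * ℏ * x₃ * y) *
            Complex.exp (((-(Real.pi * ℏ * x₂) * y ^ 2 : ℝ) : ℂ) * Complex.I) := by
          rw [← Complex.exp_add]
          congr 1
          push_cast
          ring
        rw [this]
        ring
      have e2 : Complex.exp (-(2 * Real.pi * Complex.I * h₂ * x₂)) *
          Complex.exp (2 * Real.pi * Complex.I *
            (h₂ * x₂ + ℏ * (-(x₃ * t) + (1/2) * x₂ * t^2)))
          = Complex.exp (-(2 * Real.pi * Complex.I * ℏ * x₃ * t)) *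
            Complex.exp (Real.pi * Complex.I * ℏ * x₂ * t ^ 2) := by
        rw [← Complex.exp_add, ← Complex.exp_add]
        congr 1
        ring
      simp only [W]
      rw [e1]
      linear_combination (∫ y : ℝ, Complex.exp (2 * Real.pi * Complex.I * ℏ * x₃ * y) * g y) *
        ψ (t - x₁) * e2
    simp only [e]
    rw [integral_mul_const, key, hg]
    have e3 : Complex.exp (((-(Real.pi * ℏ * x₂) * t ^ 2 : ℝ) : ℂ) * Complex.I) *
        Complex.exp (Real.pi * Complex.I * ℏ * x₂ * t ^ 2) = 1 := by
      rw [← Complex.exp_add, ← Complex.exp_zero]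
      congr 1
      push_cast
      ring
    linear_combination (ℏ : ℂ)⁻¹ * f t * star (φ (t - x₁)) * ψ (t - x₁) * e3
  simp only [inner]
  rw [integral_const_mul, integral_mul_const,
    integral_sub_left_eq_self (fun y : ℝ => ψ y * star (φ y)) volume t, ← mul_assoc,
    mul_inv_cancel₀ (by exact_mod_cast hℏ.ne'), one_mul]
end

section
/- Let E > 0 and let φ_E(y) = exp(−πEħ y²). For every Schwartz function k : ℝ → ℂ, the function f = W_{φ_E} k satisfies the analyticity condition −i ∂₁f(x₁,x₂,x₃) + E ∂₃f(x₁,x₂,x₃) − 2πiħE x₁ f(x₁,x₂,x₃) = 0 for all (x₁,x₂,x₃) ∈ ℝ³. -/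
open MeasureTheory

/-- Partial derivative in the first variable of a function on ℝ³. -/
noncomputable def pd1 (F : ℝ × ℝ × ℝ → ℂ) : ℝ × ℝ × ℝ → ℂ :=
  fun p => deriv (fun t => F (t, p.2.1, p.2.2)) p.1

/-- Partial derivative in the third variable of a function on ℝ³. -/
noncomputable def pd3 (F : ℝ × ℝ × ℝ → ℂ) : ℝ × ℝ × ℝ → ℂ :=
  fun p => deriv (fun t => F (p.1, p.2.1, t)) p.2.2

noncomputable def GG (ℏ E b : ℝ) (k : ℝ → ℂ) (a c y : ℝ) : ℂ :=
  k y * Complex.exp (-(2 * Real.pi * Complex.I * ℏ *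
      (-(c * y) + (1/2) * b * y^2))) * Complex.exp (-(Real.pi * E * ℏ * (y - a)^2))

lemma W_eq (h₂ ℏ E : ℝ) (k : ℝ → ℂ) (a b c : ℝ) :
    W h₂ ℏ (fun y => Complex.exp (-(Real.pi * E * ℏ * y^2))) k (a, b, c) =
      Complex.exp (-(2 * Real.pi * Complex.I * h₂ * b)) * ∫ y : ℝ, GG ℏ E b k a c y := by
  unfold W GG
  congr 2
  ext y
  congr 1
  rw [Complex.star_def, ← Complex.exp_conj]
  congr 1
  simp

lemma GG_norm (ℏ E b : ℝ) (hℏ : 0 < ℏ) (hE : 0 < E) (k : ℝ → ℂ) (a c y : ℝ) :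
    ‖GG ℏ E b k a c y‖ ≤ ‖k y‖ := by
  unfold GG
  have h1 : (-(2 * Real.pi * Complex.I * ℏ * (-(c * y) + (1/2) * b * y^2)) : ℂ)
      = ((-(2 * Real.pi * ℏ * (-(c * y) + (1/2) * b * y^2)) : ℝ) : ℂ) * Complex.I := by
    push_cast; ring
  have h2 : (-(Real.pi * E * ℏ * (y - a)^2) : ℂ)
      = ((-(Real.pi * E * ℏ * (y - a)^2) : ℝ) : ℂ) := by
    push_cast; ring
  rw [norm_mul, norm_mul, h1, h2, Complex.norm_exp_ofReal_mul_I, Complex.norm_exp_ofReal, mul_one]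
  apply mul_le_of_le_one_right (norm_nonneg _)
  rw [Real.exp_le_one_iff]
  have := Real.pi_pos
  have : 0 ≤ Real.pi * E * ℏ * (y - a)^2 := by positivity
  linarith

lemma GG_cont (ℏ E b : ℝ) (k : SchwartzMap ℝ ℂ) (a c : ℝ) :
    Continuous (GG ℏ E b k a c) := by
  have := k.continuous
  unfold GG
  fun_prop

lemma GG_int (ℏ E b : ℝ) (hℏ : 0 < ℏ) (hE : 0 < E) (k : SchwartzMap ℝ ℂ) (a c : ℝ) :
    Integrable (GG ℏ E b k a c) :=
  k.integrable.mono (GG_cont ℏ E b k a c).aestronglyMeasurable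
    (Filter.Eventually.of_forall fun y => GG_norm ℏ E b hℏ hE k a c y)

lemma k_int (k : SchwartzMap ℝ ℂ) : Integrable (fun y : ℝ => |y| * ‖k y‖) := by
  simpa using k.integrable_pow_mul volume 1

lemma GG_int1 (ℏ E b : ℝ) (hℏ : 0 < ℏ) (hE : 0 < E) (k : SchwartzMap ℝ ℂ) (a c : ℝ) :
    Integrable (fun y : ℝ => (y : ℂ) * GG ℏ E b k a c y) := by
  have := GG_cont ℏ E b k a c
  refine (k_int k).mono' (by fun_prop) (Filter.Eventually.of_forall fun y => ?_)
  rw [norm_mul, Complex.norm_real, Real.norm_eq_abs]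
  exact mul_le_mul_of_nonneg_left (GG_norm ℏ E b hℏ hE k a c y) (abs_nonneg y)

lemma d1 (ℏ E b : ℝ) (hℏ : 0 < ℏ) (hE : 0 < E) (k : SchwartzMap ℝ ℂ) (a c : ℝ) :
    HasDerivAt (fun t : ℝ => ∫ y : ℝ, GG ℏ E b k t c y)
      (∫ y : ℝ, (2 * Real.pi * E * ℏ * (y - a)) * GG ℏ E b k a c y) a := by
  have hc := fun t => GG_cont ℏ E b k t c
  refine (hasDerivAt_integral_of_dominated_loc_of_deriv_le (Metric.ball_mem_nhds a one_pos)
    (F := fun t y => GG ℏ E b k t c y)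
    (F' := fun t y => (2 * Real.pi * E * ℏ * (y - t)) * GG ℏ E b k t c y)
    (bound := fun y => 2 * Real.pi * E * ℏ * (|y| * ‖k y‖ + (|a| + 1) * ‖k y‖))
    (Filter.Eventually.of_forall fun t => (hc t).aestronglyMeasurable)
    (GG_int ℏ E b hℏ hE k a c) ?_ ?_ ?_ ?_).2
  · have := hc a
    fun_prop
  · refine Filter.Eventually.of_forall fun y t ht => ?_
    have hp := Real.pi_pos
    have h1 : (2 * Real.pi * E * ℏ * (y - t) : ℂ) = ((2 * Real.pi * E * ℏ * (y - t) : ℝ) : ℂ) := by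
      push_cast; ring
    have h0 : 0 < 2 * Real.pi * E * ℏ := by positivity
    rw [norm_mul, h1, Complex.norm_real, Real.norm_eq_abs, abs_mul, abs_of_pos h0, mul_assoc,
      ← add_mul]
    refine mul_le_mul_of_nonneg_left ?_ h0.le
    refine mul_le_mul ?_ (GG_norm ℏ E b hℏ hE k t c y) (norm_nonneg _) (by positivity)
    rw [Metric.mem_ball, Real.dist_eq] at ht
    have e1 := abs_sub y t
    have e2 := abs_sub_abs_le_abs_sub t a
    have e3 := abs_sub_le y 0 t
    simp at e3
    linarith
  · exact ((k_int k).add (k.integrable.norm.const_mul _)).const_mul _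
  · refine Filter.Eventually.of_forall fun y t ht => ?_
    have h : HasDerivAt (fun t : ℝ => (-(Real.pi * E * ℏ * ((y:ℂ) - t)^2) : ℂ))
        (2 * Real.pi * E * ℏ * (y - t)) t := by
      have := ((((hasDerivAt_id t).ofReal_comp.const_sub (y:ℂ)).pow 2).const_mul
        (Real.pi * E * ℏ : ℂ)).neg
      refine this.congr_deriv ?_
      simp; ring
    refine (h.cexp.const_mul _).congr_deriv ?_
    unfold GG
    ring

lemma d3 (ℏ E b : ℝ) (hℏ : 0 < ℏ) (hE : 0 < E) (k : SchwartzMap ℝ ℂ) (a c : ℝ) :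
    HasDerivAt (fun t : ℝ => ∫ y : ℝ, GG ℏ E b k a t y)
      (∫ y : ℝ, (2 * Real.pi * Complex.I * ℏ) * (y * GG ℏ E b k a c y)) c := by
  have hc := fun t => GG_cont ℏ E b k a t
  refine (hasDerivAt_integral_of_dominated_loc_of_deriv_le (Metric.ball_mem_nhds c one_pos)
    (F := fun t y => GG ℏ E b k a t y)
    (F' := fun t y => (2 * Real.pi * Complex.I * ℏ) * (y * GG ℏ E b k a t y))
    (bound := fun y => ‖(2 * Real.pi * Complex.I * ℏ : ℂ)‖ * (|y| * ‖k y‖))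
    (Filter.Eventually.of_forall fun t => (hc t).aestronglyMeasurable)
    (GG_int ℏ E b hℏ hE k a c) ?_ ?_ ?_ ?_).2
  · have := hc c
    fun_prop
  · refine Filter.Eventually.of_forall fun y t ht => ?_
    rw [norm_mul, norm_mul (y : ℂ), Complex.norm_real, Real.norm_eq_abs]
    have := GG_norm ℏ E b hℏ hE k a t y
    gcongr
  · exact (k_int k).const_mul _
  · refine Filter.Eventually.of_forall fun y t ht => ?_
    have h : HasDerivAt (fun t : ℝ => (-(2 * Real.pi * Complex.I * ℏ *
        (-((t:ℂ) * y) + (1/2) * b * y^2)) : ℂ)) (2 * Real.pi * Complex.I * ℏ * y) t := by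
      have := ((((hasDerivAt_id t).ofReal_comp.mul_const (y:ℂ)).neg.add_const
        ((1/2) * b * y^2 : ℂ)).const_mul (2 * Real.pi * Complex.I * ℏ : ℂ)).neg
      refine this.congr_deriv ?_
      simp
    refine ((h.cexp.const_mul (k y)).mul_const _).congr_deriv ?_
    unfold GG
    ring

theorem stmt7 (h₂ ℏ E : ℝ) (hℏ : 0 < ℏ) (hE : 0 < E) (k : SchwartzMap ℝ ℂ)
    (f : ℝ × ℝ × ℝ → ℂ)
    (hf : f = W h₂ ℏ (fun y => Complex.exp (-(Real.pi * E * ℏ * y^2))) k) :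
    ∀ p : ℝ × ℝ × ℝ,
      -Complex.I * pd1 f p + E * pd3 f p
        - 2 * Real.pi * Complex.I * ℏ * E * p.1 * f p = 0 := by
  rintro ⟨a, b, c⟩
  subst hf
  simp only [pd1, pd3, W_eq]
  rw [((d1 ℏ E b hℏ hE k a c).const_mul _).deriv, ((d3 ℏ E b hℏ hE k a c).const_mul _).deriv]
  have e : (∫ y : ℝ, (2 * Real.pi * E * ℏ * (y - a)) * GG ℏ E b k a c y)
      = 2 * Real.pi * E * ℏ * (∫ y : ℝ, y * GG ℏ E b k a c y)
        - 2 * Real.pi * E * ℏ * a * ∫ y : ℝ, GG ℏ E b k a c y := by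
    rw [← integral_const_mul, ← integral_const_mul, ← integral_sub
      ((GG_int1 ℏ E b hℏ hE k a c).const_mul _) ((GG_int ℏ E b hℏ hE k a c).const_mul _)]
    congr 1
    ext y
    ring
  rw [e, integral_const_mul]
  ring
end

section
/- For every pair of Schwartz functions φ, k : ℝ → ℂ, the function f = W_φ k satisfies the structural condition ∂₃₃f(x₁,x₂,x₃) + 4πiħ ∂₂f(x₁,x₂,x₃) − 8π²h₂ħ f(x₁,x₂,x₃) = 0 for all (x₁,x₂,x₃) ∈ ℝ³ (i.e. the Casimir operator acts on the image of the coherent state transform as the scalar 8π²h₂ħ). -/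
open MeasureTheory

/-- Partial derivative in the second variable of a function on ℝ³. -/
noncomputable def pd2 (F : ℝ × ℝ × ℝ → ℂ) : ℝ × ℝ × ℝ → ℂ :=
  fun p => deriv (fun t => F (p.1, t, p.2.2)) p.2.1

lemma stmt8_aux (G : ℝ → ℂ) (a b : ℝ → ℝ) (hG : Continuous G) (ha : Continuous a)
    (hb : Continuous b) (h0 : Integrable G) (h1 : Integrable (fun y => (a y : ℂ) * G y)) (t₀ : ℝ) :
    HasDerivAt (fun t : ℝ => ∫ y, G y * Complex.exp (((a y * t + b y : ℝ) : ℂ) * Complex.I))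
      (∫ y, Complex.I * ((a y : ℂ) * G y) * Complex.exp (((a y * t₀ + b y : ℝ) : ℂ) * Complex.I))
      t₀ := by
  refine (hasDerivAt_integral_of_dominated_loc_of_deriv_le (μ := volume) (s := Set.univ)
    (F := fun (t : ℝ) y => G y * Complex.exp (((a y * t + b y : ℝ) : ℂ) * Complex.I))
    (F' := fun (t : ℝ) y => Complex.I * ((a y : ℂ) * G y) *
      Complex.exp (((a y * t + b y : ℝ) : ℂ) * Complex.I))
    (bound := fun y => ‖(a y : ℂ) * G y‖) Filter.univ_mem ?_ ?_ ?_ ?_ h1.norm ?_).2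
  · refine Filter.Eventually.of_forall fun t => Continuous.aestronglyMeasurable ?_
    fun_prop
  · refine h0.mono (Continuous.aestronglyMeasurable (by fun_prop)) ?_
    refine Filter.Eventually.of_forall fun y => ?_
    rw [norm_mul, Complex.norm_exp_ofReal_mul_I, mul_one]
  · refine Continuous.aestronglyMeasurable ?_
    fun_prop
  · refine Filter.Eventually.of_forall fun y t _ => ?_
    rw [norm_mul, Complex.norm_exp_ofReal_mul_I, mul_one, norm_mul, Complex.norm_I, one_mul]
  · refine Filter.Eventually.of_forall fun y t _ => ?_
    have h : HasDerivAt (fun t : ℝ => ((a y * t + b y : ℝ) : ℂ) * Complex.I)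
        ((a y : ℂ) * Complex.I) t := by
      have h' : HasDerivAt (fun t : ℝ => a y * t + b y) (a y) t := by
        simpa using ((hasDerivAt_id t).const_mul (a y)).add_const (b y)
      exact h'.ofReal_comp.mul_const _
    convert! (h.cexp.const_mul (G y)) using 1
    ring

noncomputable def stmt8G (φ k : SchwartzMap ℝ ℂ) (x : ℝ) (n : ℕ) (y : ℝ) : ℂ :=
  (y : ℂ) ^ n * (k y * star (φ (y - x)))

lemma stmt8G_cont (φ k : SchwartzMap ℝ ℂ) (x : ℝ) (n : ℕ) : Continuous (stmt8G φ k x n) := by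
  have h1 := k.continuous
  have h2 := φ.continuous
  unfold stmt8G
  fun_prop

lemma stmt8G_int (φ k : SchwartzMap ℝ ℂ) (x : ℝ) (n : ℕ) : Integrable (stmt8G φ k x n) := by
  obtain ⟨C, hC⟩ := φ.decay 0 0
  have hk := (k.integrable_pow_mul volume n).mul_const C
  refine hk.mono' (stmt8G_cont φ k x n).aestronglyMeasurable ?_
  refine Filter.Eventually.of_forall fun y => ?_
  have := hC.2 (y - x)
  simp only [pow_zero, one_mul, norm_iteratedFDeriv_zero] at this
  simp only [stmt8G, norm_mul, norm_pow, norm_star, Complex.norm_real]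
  rw [← mul_assoc]
  gcongr

noncomputable def stmt8J (ℏ : ℝ) (φ k : SchwartzMap ℝ ℂ) (n : ℕ) (x u v : ℝ) : ℂ :=
  ∫ y, stmt8G φ k x n y * Complex.exp (-(2 * Real.pi * Complex.I * ℏ *
      (-(v * y) + (1/2) * u * y^2)))

lemma stmt8J_d3 (ℏ : ℝ) (φ k : SchwartzMap ℝ ℂ) (n : ℕ) (x u v : ℝ) :
    HasDerivAt (fun t : ℝ => stmt8J ℏ φ k n x u t)
      (2 * Real.pi * Complex.I * ℏ * stmt8J ℏ φ k (n+1) x u v) v := by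
  have h := stmt8_aux (stmt8G φ k x n) (fun y => 2 * Real.pi * ℏ * y)
    (fun y => - (Real.pi * ℏ * u * y^2)) (stmt8G_cont φ k x n) (by fun_prop) (by fun_prop)
    (stmt8G_int φ k x n) (by
      refine ((stmt8G_int φ k x (n+1)).const_mul (2 * Real.pi * ℏ : ℂ)).congr ?_
      refine Filter.Eventually.of_forall fun y => ?_
      simp only [stmt8G]; push_cast; ring) v
  unfold stmt8J
  rw [← integral_const_mul]
  convert! h using 1
  · funext t; congr 1; funext y; congr 2; push_cast; ring
  · congr 1; funext y
    rw [← mul_assoc]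
    congr 1
    · simp only [stmt8G]; push_cast; ring
    · congr 1; push_cast; ring

lemma stmt8J_d2 (ℏ : ℝ) (φ k : SchwartzMap ℝ ℂ) (n : ℕ) (x u v : ℝ) :
    HasDerivAt (fun t : ℝ => stmt8J ℏ φ k n x t v)
      (-(Real.pi * Complex.I * ℏ) * stmt8J ℏ φ k (n+2) x u v) u := by
  have h := stmt8_aux (stmt8G φ k x n) (fun y => -(Real.pi * ℏ * y^2))
    (fun y => 2 * Real.pi * ℏ * v * y) (stmt8G_cont φ k x n) (by fun_prop) (by fun_prop)
    (stmt8G_int φ k x n) (by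
      refine ((stmt8G_int φ k x (n+2)).const_mul (-(Real.pi * ℏ) : ℂ)).congr ?_
      refine Filter.Eventually.of_forall fun y => ?_
      simp only [stmt8G]; push_cast; ring) u
  unfold stmt8J
  rw [← integral_const_mul]
  convert! h using 1
  · funext t; congr 1; funext y; congr 2; push_cast; ring
  · congr 1; funext y
    rw [← mul_assoc]
    congr 1
    · simp only [stmt8G]; push_cast; ring
    · congr 1; push_cast; ring

lemma stmt8_W (h₂ ℏ : ℝ) (φ k : SchwartzMap ℝ ℂ) (x u v : ℝ) :
    W h₂ ℏ φ k (x, u, v) =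
      Complex.exp (-(2 * Real.pi * Complex.I * h₂ * u)) * stmt8J ℏ φ k 0 x u v := by
  unfold W stmt8J stmt8G
  congr 2
  funext y
  simp only [pow_zero, one_mul]
  ring

theorem stmt8 (h₂ ℏ : ℝ) (hℏ : 0 < ℏ) (φ k : SchwartzMap ℝ ℂ)
    (f : ℝ × ℝ × ℝ → ℂ) (hf : f = W h₂ ℏ φ k) :
    ∀ p : ℝ × ℝ × ℝ,
      pd3 (pd3 f) p + 4 * Real.pi * Complex.I * ℏ * pd2 f p
        - 8 * Real.pi^2 * h₂ * ℏ * f p = 0 := by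
  subst hf
  rintro ⟨x, u, v⟩
  have e3 : ∀ v : ℝ, pd3 (W h₂ ℏ φ k) (x, u, v) =
      Complex.exp (-(2 * Real.pi * Complex.I * h₂ * u)) *
        (2 * Real.pi * Complex.I * ℏ * stmt8J ℏ φ k 1 x u v) := by
    intro v
    simp only [pd3, stmt8_W]
    exact ((stmt8J_d3 ℏ φ k 0 x u v).const_mul _).deriv
  have e33 : pd3 (pd3 (W h₂ ℏ φ k)) (x, u, v) =
      Complex.exp (-(2 * Real.pi * Complex.I * h₂ * u)) *
        (2 * Real.pi * Complex.I * ℏ * (2 * Real.pi * Complex.I * ℏ *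
          stmt8J ℏ φ k 2 x u v)) := by
    rw [pd3]
    simp only [e3]
    exact (((stmt8J_d3 ℏ φ k 1 x u v).const_mul _).const_mul _).deriv
  have hE : HasDerivAt (fun t : ℝ => Complex.exp (-(2 * Real.pi * Complex.I * h₂ * t)))
      (Complex.exp (-(2 * Real.pi * Complex.I * h₂ * u)) *
        (-(2 * Real.pi * Complex.I * h₂))) u := by
    have := ((Complex.ofRealCLM.hasDerivAt (x := u)).const_mul
      (2 * Real.pi * Complex.I * h₂ : ℂ)).neg.cexp
    simpa using this
  have e2 : pd2 (W h₂ ℏ φ k) (x, u, v) =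
      Complex.exp (-(2 * Real.pi * Complex.I * h₂ * u)) * (-(2 * Real.pi * Complex.I * h₂)) *
        stmt8J ℏ φ k 0 x u v + Complex.exp (-(2 * Real.pi * Complex.I * h₂ * u)) *
        (-(Real.pi * Complex.I * ℏ) * stmt8J ℏ φ k 2 x u v) := by
    simp only [pd2, stmt8_W]
    exact (hE.mul (stmt8J_d2 ℏ φ k 0 x u v)).deriv
  rw [e33, e2, stmt8_W]
  linear_combination (-8 * Real.pi^2 * h₂ * ℏ *
    Complex.exp (-(2 * Real.pi * Complex.I * h₂ * u)) * stmt8J ℏ φ k 0 x u v) * Complex.I_sq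
end

section
/- Let E > 0 and q > 0, and for a > 0 set φ_a(y) = exp(−πħa y²). Then for all (x₁,x₂,x₃) ∈ ℝ³ the coherent state transform of one Gaussian against another evaluates to [W_{φ_E} φ_q](x₁,x₂,x₃) = ħ^{−1/2} (ix₂ + E + q)^{−1/2} · exp(−2πi h₂x₂ − πħE x₁² − πħ (x₃ − iEx₁)² / (ix₂ + E + q)), where the square root of ix₂ + E + q is the principal branch (well defined since Re(ix₂ + E + q) > 0). -/
open MeasureTheory

theorem stmt9 (h₂ ℏ E q : ℝ) (hℏ : 0 < ℏ) (hE : 0 < E) (hq : 0 < q) (x : ℝ × ℝ × ℝ) :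
    W h₂ ℏ (fun y => Complex.exp (-(Real.pi * ℏ * E * y^2)))
        (fun y => Complex.exp (-(Real.pi * ℏ * q * y^2))) x
      = (ℏ : ℂ) ^ (-(1/2) : ℂ) * (Complex.I * x.2.1 + E + q) ^ (-(1/2) : ℂ) *
          Complex.exp (-(2 * Real.pi * Complex.I * h₂ * x.2.1)
            - Real.pi * ℏ * E * x.1^2
            - Real.pi * ℏ * (x.2.2 - Complex.I * E * x.1)^2
                / (Complex.I * x.2.1 + E + q)) := by
  obtain ⟨x₁, x₂, x₃⟩ := x
  have hpi : (Real.pi : ℂ) ≠ 0 := by exact_mod_cast Real.pi_ne_zero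
  have hh : (ℏ : ℂ) ≠ 0 := by exact_mod_cast hℏ.ne'
  simp only [W]
  set s : ℂ := Complex.I * x₂ + E + q with hs
  have hsre : 0 < s.re := by simp [hs]; linarith
  have hs0 : s ≠ 0 := by
    intro h
    rw [h] at hsre
    simp at hsre
  have hb : (-(((Real.pi * ℏ : ℝ) : ℂ) * s)).re < 0 := by
    rw [Complex.neg_re, Complex.re_ofReal_mul]
    have := mul_pos (mul_pos Real.pi_pos hℏ) hsre
    linarith
  have key : ∀ y : ℝ, Complex.exp (-(Real.pi * ℏ * q * (y : ℂ)^2)) *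
      Complex.exp (-(2 * Real.pi * Complex.I * ℏ *
      (-(x₃ * y) + (1/2) * x₂ * (y : ℂ)^2))) *
      star (Complex.exp (-(Real.pi * ℏ * E * ((y - x₁ : ℝ) : ℂ)^2))) =
      Complex.exp (-(((Real.pi * ℏ : ℝ) : ℂ) * s) * (y : ℂ)^2
        + (2 * Real.pi * ℏ * (Complex.I * x₃ + E * x₁)) * y
        + (-(Real.pi * ℏ * E * (x₁ : ℂ)^2))) := by
    intro y
    have h1 : star (Complex.exp (-(Real.pi * ℏ * E * ((y - x₁ : ℝ) : ℂ)^2))) =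
        Complex.exp (-(Real.pi * ℏ * E * ((y - x₁ : ℝ) : ℂ)^2)) := by
      change (starRingEnd ℂ) _ = _
      rw [← Complex.exp_conj]
      simp only [map_neg, map_mul, map_pow, Complex.conj_ofReal]
    rw [h1, ← Complex.exp_add, ← Complex.exp_add]
    congr 1
    rw [hs]
    push_cast
    ring
  simp_rw [key]
  rw [integral_cexp_quadratic hb]
  have hpow : ((Real.pi : ℂ) / - -(((Real.pi * ℏ : ℝ) : ℂ) * s)) ^ (1/2 : ℂ) =
      (ℏ : ℂ) ^ (-(1/2) : ℂ) * s ^ (-(1/2) : ℂ) := by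
    have e : (Real.pi : ℂ) / - -(((Real.pi * ℏ : ℝ) : ℂ) * s) = ((ℏ⁻¹ : ℝ) : ℂ) * s⁻¹ := by
      push_cast
      field_simp
      try simp
    have harg : s.arg ≠ Real.pi := by
      intro h
      rw [Complex.arg_eq_pi_iff] at h
      linarith [h.1]
    have harg2 : (ℏ : ℂ).arg ≠ Real.pi := by
      rw [Complex.arg_ofReal_of_nonneg hℏ.le]
      exact Real.pi_ne_zero.symm
    have hi : 0 < ℏ⁻¹ := inv_pos.2 hℏ
    have hi0 : ((ℏ⁻¹ : ℝ) : ℂ) ≠ 0 := by exact_mod_cast hi.ne'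
    have hmul : (((ℏ⁻¹ : ℝ) : ℂ) * s⁻¹) ^ (1/2 : ℂ) =
        ((ℏ⁻¹ : ℝ) : ℂ) ^ (1/2 : ℂ) * s⁻¹ ^ (1/2 : ℂ) := by
      rw [Complex.cpow_def_of_ne_zero (mul_ne_zero hi0 (inv_ne_zero hs0)),
        Complex.cpow_def_of_ne_zero hi0, Complex.cpow_def_of_ne_zero (inv_ne_zero hs0),
        Complex.log_ofReal_mul hi (inv_ne_zero hs0), Complex.ofReal_log hi.le, add_mul,
        Complex.exp_add]
    rw [e, hmul, Complex.ofReal_inv,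
      Complex.inv_cpow _ _ harg, Complex.inv_cpow _ _ harg2, Complex.cpow_neg, Complex.cpow_neg]
  rw [hpow, mul_left_comm, ← Complex.exp_add]
  congr 2
  push_cast
  field_simp
  ring_nf
  simp only [Complex.I_sq]
  ring
end

section
/- Let m, ω, ħ > 0 and let f : ℝ² → ℂ (variables (x₁,x₃)) be twice continuously differentiable and satisfy the analyticity condition −i ∂₁f + mω ∂₃f − 2πiħmω x₁ f = 0 identically. Then the second-order harmonic oscillator Hamiltonian reduces to a first-order operator on f: for all (x₁,x₃), −(1/(4πm)) ∂₁₁f − (mω²/(4π)) ∂₃₃f + (iħ/m) x₃ ∂₁f + (πħ²/m) x₃² f = (iħ/m) x₃ ∂₁f − iħmω² x₁ ∂₃f + ((1/2)ħω + (πħ²/m)(x₃² − m²ω²x₁²)) f. -/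
/-- Partial derivative in the first variable (x₁) of a function on ℝ². -/
noncomputable def q1 (F : ℝ × ℝ → ℂ) : ℝ × ℝ → ℂ :=
  fun p => deriv (fun t => F (t, p.2)) p.1

/-- Partial derivative in the second variable (x₃) of a function on ℝ². -/
noncomputable def q3 (F : ℝ × ℝ → ℂ) : ℝ × ℝ → ℂ :=
  fun p => deriv (fun t => F (p.1, t)) p.2

theorem aux1 {F : ℝ × ℝ → ℂ} {p : ℝ × ℝ} (h : DifferentiableAt ℝ F p) :
    HasDerivAt (fun t => F (t, p.2)) (fderiv ℝ F p (1, 0)) p.1 := by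
  have h1 : HasDerivAt (fun t : ℝ => ((t, p.2) : ℝ × ℝ)) (1, 0) p.1 :=
    (hasDerivAt_id p.1).prodMk (hasDerivAt_const p.1 p.2)
  exact HasFDerivAt.comp_hasDerivAt (f := fun t : ℝ => ((t, p.2) : ℝ × ℝ)) p.1 h.hasFDerivAt h1

theorem aux3 {F : ℝ × ℝ → ℂ} {p : ℝ × ℝ} (h : DifferentiableAt ℝ F p) :
    HasDerivAt (fun t => F (p.1, t)) (fderiv ℝ F p (0, 1)) p.2 := by
  have h1 : HasDerivAt (fun t : ℝ => ((p.1, t) : ℝ × ℝ)) (0, 1) p.2 :=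
    (hasDerivAt_const p.2 p.1).prodMk (hasDerivAt_id p.2)
  exact HasFDerivAt.comp_hasDerivAt (f := fun t : ℝ => ((p.1, t) : ℝ × ℝ)) p.2 h.hasFDerivAt h1

theorem stmt11 (m ω ℏ : ℝ) (hm : 0 < m) (hω : 0 < ω) (hℏ : 0 < ℏ)
    (f : ℝ × ℝ → ℂ) (hf : ContDiff ℝ 2 f)
    (hA : ∀ p : ℝ × ℝ,
      -Complex.I * q1 f p + m * ω * q3 f p
        - 2 * Real.pi * Complex.I * ℏ * m * ω * p.1 * f p = 0) :
    ∀ p : ℝ × ℝ,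
      -(1 / (4 * Real.pi * m)) * q1 (q1 f) p
          - (m * ω^2 / (4 * Real.pi)) * q3 (q3 f) p
          + (Complex.I * ℏ / m) * p.2 * q1 f p
          + (Real.pi * ℏ^2 / m) * p.2^2 * f p
        = (Complex.I * ℏ / m) * p.2 * q1 f p
          - Complex.I * ℏ * m * ω^2 * p.1 * q3 f p
          + ((1/2) * ℏ * ω + (Real.pi * ℏ^2 / m) * (p.2^2 - m^2 * ω^2 * p.1^2)) * f p := by
  intro p
  have hd : Differentiable ℝ f := hf.differentiable (by norm_num)
  have hdd : Differentiable ℝ (fderiv ℝ f) :=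
    (hf.fderiv_right (m := 1) (by norm_num)).differentiable (by norm_num)
  have e1 : q1 f = fun p => fderiv ℝ f p (1, 0) := funext fun p => (aux1 (hd p)).deriv
  have e3 : q3 f = fun p => fderiv ℝ f p (0, 1) := funext fun p => (aux3 (hd p)).deriv
  have d1 : Differentiable ℝ (q1 f) := by
    rw [e1]; exact hdd.clm_apply (differentiable_const _)
  have d3 : Differentiable ℝ (q3 f) := by
    rw [e3]; exact hdd.clm_apply (differentiable_const _)
  have hsym : q3 (q1 f) p = q1 (q3 f) p := by
    have a : q3 (q1 f) p = fderiv ℝ (q1 f) p (0, 1) := (aux3 (d1 p)).deriv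
    have b : q1 (q3 f) p = fderiv ℝ (q3 f) p (1, 0) := (aux1 (d3 p)).deriv
    have s : IsSymmSndFDerivAt ℝ f p := hf.contDiffAt.isSymmSndFDerivAt (by simp)
    have s' := s (0, 1) (1, 0)
    rw [a, b, e1, e3, fderiv_clm_apply (hdd p) (differentiableAt_const _),
      fderiv_clm_apply (hdd p) (differentiableAt_const _)]
    simpa using s'
  have r1 : HasDerivAt (fun t => f (t, p.2)) (q1 f p) p.1 := by
    rw [e1]; exact aux1 (hd p)
  have r3 : HasDerivAt (fun t => f (p.1, t)) (q3 f p) p.2 := by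
    rw [e3]; exact aux3 (hd p)
  have r11 : HasDerivAt (fun t => q1 f (t, p.2)) (q1 (q1 f) p) p.1 :=
    (aux1 (d1 p)).differentiableAt.hasDerivAt
  have r31 : HasDerivAt (fun t => q3 f (t, p.2)) (q1 (q3 f) p) p.1 :=
    (aux1 (d3 p)).differentiableAt.hasDerivAt
  have r13 : HasDerivAt (fun t => q1 f (p.1, t)) (q3 (q1 f) p) p.2 :=
    (aux3 (d1 p)).differentiableAt.hasDerivAt
  have r33 : HasDerivAt (fun t => q3 f (p.1, t)) (q3 (q3 f) p) p.2 :=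
    (aux3 (d3 p)).differentiableAt.hasDerivAt
  have hx : HasDerivAt (fun t : ℝ => (t : ℂ)) 1 p.1 := Complex.ofRealCLM.hasDerivAt
  have A1 : -Complex.I * q1 (q1 f) p + m * ω * q1 (q3 f) p
      - (2 * Real.pi * Complex.I * ℏ * m * ω) * (1 * f p + p.1 * q1 f p) = 0 := by
    have h := ((r11.const_mul (-Complex.I)).add (r31.const_mul ((m : ℂ) * ω))).sub
      ((hx.mul r1).const_mul (2 * Real.pi * Complex.I * ℏ * m * ω))
    refine h.unique ((hasDerivAt_const p.1 (0 : ℂ)).congr_of_eventuallyEq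
      (Filter.Eventually.of_forall fun t => ?_))
    have := hA (t, p.2)
    simp only [Pi.add_apply, Pi.sub_apply, Pi.mul_apply] at this ⊢
    linear_combination this
  have A3 : -Complex.I * q3 (q1 f) p + m * ω * q3 (q3 f) p
      - (2 * Real.pi * Complex.I * ℏ * m * ω * p.1) * q3 f p = 0 := by
    have h := ((r13.const_mul (-Complex.I)).add (r33.const_mul ((m : ℂ) * ω))).sub
      (r3.const_mul (2 * Real.pi * Complex.I * ℏ * m * ω * p.1))
    refine h.unique ((hasDerivAt_const p.2 (0 : ℂ)).congr_of_eventuallyEq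
      (Filter.Eventually.of_forall fun t => ?_))
    have := hA (p.1, t)
    simp only [Pi.add_apply, Pi.sub_apply, Pi.mul_apply] at this ⊢
    linear_combination this
  rw [hsym] at A3
  have A0 := hA p
  have hm' : (m : ℂ) ≠ 0 := by exact_mod_cast hm.ne'
  have hpi : (Real.pi : ℂ) ≠ 0 := by exact_mod_cast Real.pi_ne_zero
  have hI : Complex.I ^ 2 = -1 := Complex.I_sq
  generalize q1 (q1 f) p = f11 at *
  generalize q1 (q3 f) p = f13 at *
  generalize q3 (q3 f) p = f33 at *
  generalize q1 f p = f1 at *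
  generalize q3 f p = f3 at *
  generalize f p = f0 at *
  generalize Complex.I = I at *
  have B0 : f1 = -I * m * ω * f3 - 2 * Real.pi * ℏ * m * ω * p.1 * f0 := by
    linear_combination I * A0 + (f1 + 2 * Real.pi * ℏ * m * ω * p.1 * f0) * hI
  have B1 : f11 = -I * m * ω * f13 - 2 * Real.pi * ℏ * m * ω * (f0 + p.1 * f1) := by
    linear_combination I * A1 + (f11 + 2 * Real.pi * ℏ * m * ω * (f0 + p.1 * f1)) * hI
  have B3 : f13 = -I * m * ω * f33 - 2 * Real.pi * ℏ * m * ω * p.1 * f3 := by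
    linear_combination I * A3 + (f13 + 2 * Real.pi * ℏ * m * ω * p.1 * f3) * hI
  have B : f11 = -(m * ω)^2 * f33 + 2 * I * (m * ω) * (2 * Real.pi * ℏ * m * ω) * p.1 * f3
      - (2 * Real.pi * ℏ * m * ω) * f0 + (2 * Real.pi * ℏ * m * ω)^2 * p.1^2 * f0 := by
    rw [B1, B3, B0]
    linear_combination (m * ω)^2 * f33 * hI
  rw [B]
  field_simp
  ring
end

section
/- Let m, ω, ħ, E > 0 and h₂ ∈ ℝ. Let f : ℝ³ → ℂ be twice continuously differentiable and satisfy both the analyticity condition −i∂₁f + E∂₃f − 2πiħE x₁ f = 0 and the structural condition ∂₃₃f + 4πiħ∂₂f − 8π²h₂ħ f = 0 identically. Then at every point Hf = H₁f, where Hf = −(1/(4πm))∂₁₁f − ((x₂² + m²ω²)/(4πm))∂₃₃f − (x₂/(2πm))∂₁₃f + (iħ/m)x₃∂₁f + (iħ/m)x₂x₃∂₃f + (1/(2m))(iħx₂ + 2πħ²x₃²)f is the harmonic oscillator Hamiltonian and H₁f = (iħ/m)((x₃ + x₁x₂)∂₁f − ((ix₂+E)² − m²ω²)∂₂f − (E²x₁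 − x₂x₃)∂₃f) − (ħ/(2m))(−8iπh₂Ex₂ − ix₂ + 4πh₂x₂² − 2πħx₃² + 4πh₂m²ω² − E − 4πh₂E² − 4iπEħx₁²x₂ + 2πħE²x₁²)f is the first-order reduced operator. -/
theorem pd1_eq {F : ℝ × ℝ × ℝ → ℂ} {p : ℝ × ℝ × ℝ} (h : DifferentiableAt ℝ F p) :
    HasDerivAt (fun t => F (t, p.2.1, p.2.2)) (fderiv ℝ F p (1, 0, 0)) p.1 := by
  have h1 : HasDerivAt (fun t : ℝ => (t, p.2.1, p.2.2)) ((1, 0, 0) : ℝ × ℝ × ℝ) p.1 :=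
    (hasDerivAt_id p.1).prodMk (hasDerivAt_const _ _)
  exact HasFDerivAt.comp_hasDerivAt (l := F) p.1 h.hasFDerivAt h1

theorem pd3_eq {F : ℝ × ℝ × ℝ → ℂ} {p : ℝ × ℝ × ℝ} (h : DifferentiableAt ℝ F p) :
    HasDerivAt (fun t => F (p.1, p.2.1, t)) (fderiv ℝ F p (0, 0, 1)) p.2.2 := by
  have h1 : HasDerivAt (fun t : ℝ => (p.1, p.2.1, t)) ((0, 0, 1) : ℝ × ℝ × ℝ) p.2.2 :=
    (hasDerivAt_const _ _).prodMk ((hasDerivAt_const _ _).prodMk (hasDerivAt_id _))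
  exact HasFDerivAt.comp_hasDerivAt (l := F) p.2.2 h.hasFDerivAt h1

theorem stmt13 (m ω ℏ E h₂ : ℝ) (hm : 0 < m) (hω : 0 < ω) (hℏ : 0 < ℏ) (hE : 0 < E)
    (f : ℝ × ℝ × ℝ → ℂ) (hf : ContDiff ℝ 2 f)
    (hA : ∀ p : ℝ × ℝ × ℝ,
      -Complex.I * pd1 f p + E * pd3 f p
        - 2 * Real.pi * Complex.I * ℏ * E * p.1 * f p = 0)
    (hS : ∀ p : ℝ × ℝ × ℝ,
      pd3 (pd3 f) p + 4 * Real.pi * Complex.I * ℏ * pd2 f p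
        - 8 * Real.pi^2 * h₂ * ℏ * f p = 0) :
    ∀ p : ℝ × ℝ × ℝ,
      -(1 / (4 * Real.pi * m)) * pd1 (pd1 f) p
        - ((p.2.1^2 + m^2 * ω^2) / (4 * Real.pi * m)) * pd3 (pd3 f) p
        - (p.2.1 / (2 * Real.pi * m)) * pd1 (pd3 f) p
        + (Complex.I * ℏ / m) * p.2.2 * pd1 f p
        + (Complex.I * ℏ / m) * p.2.1 * p.2.2 * pd3 f p
        + (1 / (2 * m)) * (Complex.I * ℏ * p.2.1 + 2 * Real.pi * ℏ^2 * p.2.2^2) * f p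
      = (Complex.I * ℏ / m) *
          ((p.2.2 + p.1 * p.2.1) * pd1 f p
            - ((Complex.I * p.2.1 + E)^2 - m^2 * ω^2) * pd2 f p
            - (E^2 * p.1 - p.2.1 * p.2.2) * pd3 f p)
        - (ℏ / (2 * m)) *
            (-(8 * Complex.I * Real.pi * h₂ * E * p.2.1) - Complex.I * p.2.1
              + 4 * Real.pi * h₂ * p.2.1^2 - 2 * Real.pi * ℏ * p.2.2^2
              + 4 * Real.pi * h₂ * m^2 * ω^2 - E - 4 * Real.pi * h₂ * E^2
              - 4 * Complex.I * Real.pi * E * ℏ * p.1^2 * p.2.1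
              + 2 * Real.pi * ℏ * E^2 * p.1^2) * f p := by
  intro p
  have hd : Differentiable ℝ f := hf.differentiable (by norm_num)
  have hd' : Differentiable ℝ (fderiv ℝ f) :=
    (hf.fderiv_right (m := 1) (by norm_num)).differentiable (by norm_num)
  have e1 : pd1 f = fun q => fderiv ℝ f q (1, 0, 0) := funext fun q => (pd1_eq (hd q)).deriv
  have e3 : pd3 f = fun q => fderiv ℝ f q (0, 0, 1) := funext fun q => (pd3_eq (hd q)).deriv
  have d3 : Differentiable ℝ (pd3 f) := by
    rw [e3]; exact fun q => (hd' q).clm_apply (differentiableAt_const _)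
  have d1 : Differentiable ℝ (pd1 f) := by
    rw [e1]; exact fun q => (hd' q).clm_apply (differentiableAt_const _)
  have hsymm : pd1 (pd3 f) p = pd3 (pd1 f) p := by
    have a : pd1 (pd3 f) p = fderiv ℝ (pd3 f) p (1, 0, 0) := (pd1_eq (d3 p)).deriv
    have b : pd3 (pd1 f) p = fderiv ℝ (pd1 f) p (0, 0, 1) := (pd3_eq (d1 p)).deriv
    rw [a, b, e1, e3, fderiv_clm_apply (hd' p) (differentiableAt_const _),
      fderiv_clm_apply (hd' p) (differentiableAt_const _)]
    have hs : IsSymmSndFDerivAt ℝ f p := hf.contDiffAt.isSymmSndFDerivAt (by simp)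
    simpa using hs.eq (1, 0, 0) (0, 0, 1)
  have hA' : ∀ q : ℝ × ℝ × ℝ, pd1 f q
      = -(Complex.I * E) * pd3 f q - (2 * Real.pi * ℏ * E) * (q.1 * f q) := by
    intro q
    linear_combination Complex.I * hA q + (pd1 f q
      + 2 * Real.pi * ℏ * E * q.1 * f q) * Complex.I_mul_I
  have k3 : pd3 (pd1 f) p = -(Complex.I * E) * pd3 (pd3 f) p
      - (2 * Real.pi * ℏ * E) * (p.1 * pd3 f p) := by
    have g1 := (pd3_eq (d3 p)).differentiableAt.hasDerivAt
    have g2 := (pd3_eq (hd p)).differentiableAt.hasDerivAt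
    have g := (g1.const_mul (-(Complex.I * E))).sub
      ((g2.const_mul (p.1 : ℂ)).const_mul (2 * Real.pi * ℏ * E : ℂ))
    have : pd3 (pd1 f) p = _ := Eq.trans (by
      unfold pd3
      congr 1
      funext t
      exact hA' (p.1, p.2.1, t)) g.deriv
    exact this
  have k1 : pd1 (pd1 f) p = -(Complex.I * E) * pd1 (pd3 f) p
      - (2 * Real.pi * ℏ * E) * (1 * f p + p.1 * pd1 f p) := by
    have g1 := (pd1_eq (d3 p)).differentiableAt.hasDerivAt
    have g2 := (pd1_eq (hd p)).differentiableAt.hasDerivAt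
    have g0 : HasDerivAt (fun t : ℝ => (t : ℂ)) 1 p.1 := Complex.ofRealCLM.hasDerivAt
    have g := (g1.const_mul (-(Complex.I * E))).sub
      ((g0.mul g2).const_mul (2 * Real.pi * ℏ * E : ℂ))
    have : pd1 (pd1 f) p = _ := Eq.trans (by
      conv_lhs => unfold pd1
      congr 1
      funext t
      exact hA' (t, p.2.1, p.2.2)) g.deriv
    exact this
  have k33 : pd3 (pd3 f) p = -(4 * Real.pi * Complex.I * ℏ * pd2 f p)
        + 8 * Real.pi^2 * h₂ * ℏ * f p := by linear_combination hS p
  rw [k1, hsymm, k3, k33, hA' p]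
  have hm' : (m : ℂ) ≠ 0 := by exact_mod_cast hm.ne'
  have hpi : (Real.pi : ℂ) ≠ 0 := by exact_mod_cast Real.pi_ne_zero
  generalize pd2 f p = F2
  generalize pd3 f p = F3
  generalize f p = F0
  generalize (Real.pi : ℂ) = π' at *
  have I2 := Complex.I_sq
  have I3 : Complex.I ^ 3 = - Complex.I := by rw [pow_succ, I2]; ring
  field_simp
  ring_nf
  simp only [I2, I3]
  ring
end

section
/- Let m, ω, ħ, E > 0 and h₂ ∈ ℝ. The vacuum state Φ₀(x₁,x₂,x₃) = √2 (mωE)^{1/4} (ix₂ + E + mω)^{−1/2} · exp(−πħE x₁² − 2πih₂x₂ − πħ(x₃ − iEx₁)²/(ix₂ + E + mω)) (principal square root, well defined since Re(ix₂+E+mω) > 0) is annihilated by the lowering operator: L⁻Φ₀(x₁,x₂,x₃) = 0 for all (x₁,x₂,x₃) ∈ ℝ³. -/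
/-- The lowering (annihilation) operator L⁻. -/
noncomputable def Lm (m ω ℏ : ℝ) (u : ℝ × ℝ × ℝ → ℂ) : ℝ × ℝ × ℝ → ℂ :=
  fun p => (Complex.I / (2 * Real.sqrt (Real.pi * m * ω * ℏ))) *
    (-pd1 u p - (p.2.1 - Complex.I * m * ω) * pd3 u p
      + 2 * Real.pi * Complex.I * ℏ * p.2.2 * u p)

/-- The vacuum state Φ₀. -/
noncomputable def Phi0 (m ω ℏ E h₂ : ℝ) : ℝ × ℝ × ℝ → ℂ :=
  fun p => (Real.sqrt 2 : ℂ) * ((m * ω * E : ℝ) ^ ((1:ℝ)/4) : ℝ) *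
    (Complex.I * p.2.1 + E + m * ω) ^ (-(1/2) : ℂ) *
    Complex.exp (-(Real.pi * ℏ * E * p.1^2) - 2 * Real.pi * Complex.I * h₂ * p.2.1
      - Real.pi * ℏ * (p.2.2 - Complex.I * E * p.1)^2 / (Complex.I * p.2.1 + E + m * ω))

theorem stmt17 (m ω ℏ E h₂ : ℝ) (hm : 0 < m) (hω : 0 < ω) (hℏ : 0 < ℏ) (hE : 0 < E) :
    ∀ p : ℝ × ℝ × ℝ, Lm m ω ℏ (Phi0 m ω ℏ E h₂) p = 0 := by
  rintro ⟨x, y, z⟩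
  have hD : Complex.I * y + E + m * ω ≠ 0 := by
    intro h
    have h2 := congrArg Complex.re h
    simp at h2
    have := mul_pos hm hω
    linarith
  have d1 : HasDerivAt (fun t : ℝ => Phi0 m ω ℏ E h₂ (t, y, z))
      (Phi0 m ω ℏ E h₂ (x, y, z) * (-(2 * Real.pi * ℏ * E * x)
        + 2 * Real.pi * ℏ * Complex.I * E * (z - Complex.I * E * x)
          / (Complex.I * y + E + m * ω))) x := by
    have ht : HasDerivAt (fun t : ℝ => (t : ℂ)) 1 x := Complex.ofRealCLM.hasDerivAt
    have h := ((((((ht.pow 2).const_mul (Real.pi * ℏ * E : ℂ)).neg.sub_const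
      (2 * Real.pi * Complex.I * h₂ * y : ℂ)).sub
      (((((ht.const_mul (Complex.I * E)).const_sub (z : ℂ)).pow 2).const_mul
        (Real.pi * ℏ : ℂ)).div_const (Complex.I * y + E + m * ω)))).cexp).const_mul
      ((Real.sqrt 2 : ℂ) * ((m * ω * E : ℝ) ^ ((1:ℝ)/4) : ℝ) *
        (Complex.I * y + E + m * ω) ^ (-(1/2) : ℂ))
    refine h.congr_deriv ?_
    simp only [Phi0, Pi.pow_apply, Pi.neg_apply, Pi.sub_apply, mul_assoc]
    congr 3
    push_cast
    ring
  have d3 : HasDerivAt (fun t : ℝ => Phi0 m ω ℏ E h₂ (x, y, t))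
      (Phi0 m ω ℏ E h₂ (x, y, z) * (-(2 * Real.pi * ℏ * (z - Complex.I * E * x)
          / (Complex.I * y + E + m * ω)))) z := by
    have ht : HasDerivAt (fun t : ℝ => (t : ℂ)) 1 z := Complex.ofRealCLM.hasDerivAt
    have h := ((((((ht.sub_const (Complex.I * E * x)).pow 2).const_mul
        (Real.pi * ℏ : ℂ)).div_const (Complex.I * y + E + m * ω)).const_sub
        (-(Real.pi * ℏ * E * x^2) - 2 * Real.pi * Complex.I * h₂ * y : ℂ)).cexp).const_mul
      ((Real.sqrt 2 : ℂ) * ((m * ω * E : ℝ) ^ ((1:ℝ)/4) : ℝ) *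
        (Complex.I * y + E + m * ω) ^ (-(1/2) : ℂ))
    refine h.congr_deriv ?_
    simp only [Phi0, Pi.pow_apply, Pi.neg_apply, Pi.sub_apply, mul_assoc]
    congr 3
    push_cast
    ring
  simp only [Lm, pd1, pd3]
  rw [d1.deriv, d3.deriv]
  apply mul_eq_zero_of_right
  generalize Phi0 m ω ℏ E h₂ (x, y, z) = P
  field_simp
  ring_nf
  simp only [Complex.I_sq, Complex.I_pow_three]
  ring
end

section
/- Let m, ω, ħ, E > 0 and h₂ ∈ ℝ, and let Φ₀(x₁,x₂,x₃) = √2 (mωE)^{1/4} (ix₂ + E + mω)^{−1/2} · exp(−πħE x₁² − 2πih₂x₂ − πħ(x₃ − iEx₁)²/(ix₂ + E + mω)) (principal square root). Define Φⱼ = (L⁺)ʲ Φ₀ for every natural number j. Then each Φⱼ is an eigenfunction of the harmonic oscillator Hamiltonian: H Φⱼ = ħω (j + 1/2) Φⱼ on all of ℝ³. -/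
/-- The raising (creation) operator L⁺. -/
noncomputable def Lp (m ω ℏ : ℝ) (u : ℝ × ℝ × ℝ → ℂ) : ℝ × ℝ × ℝ → ℂ :=
  fun p => (Complex.I / (2 * Real.sqrt (Real.pi * m * ω * ℏ))) *
    (-pd1 u p - (p.2.1 + Complex.I * m * ω) * pd3 u p
      + 2 * Real.pi * Complex.I * ℏ * p.2.2 * u p)

/-- The harmonic oscillator Hamiltonian on the image space over 𝔾/Z. -/
noncomputable def Hop (m ω ℏ : ℝ) (u : ℝ × ℝ × ℝ → ℂ) : ℝ × ℝ × ℝ → ℂ :=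
  fun p => -(1 / (4 * Real.pi * m)) * pd1 (pd1 u) p
    - ((p.2.1^2 + m^2 * ω^2) / (4 * Real.pi * m)) * pd3 (pd3 u) p
    - (p.2.1 / (2 * Real.pi * m)) * pd1 (pd3 u) p
    + (Complex.I * ℏ / m) * p.2.2 * pd1 u p
    + (Complex.I * ℏ / m) * p.2.1 * p.2.2 * pd3 u p
    + (1 / (2 * m)) * (Complex.I * ℏ * p.2.1 + 2 * Real.pi * ℏ^2 * p.2.2^2) * u p

/-- The excited states Φⱼ = (L⁺)ʲ Φ₀. -/
noncomputable def Phi (m ω ℏ E h₂ : ℝ) : ℕ → (ℝ × ℝ × ℝ → ℂ)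
  | 0 => Phi0 m ω ℏ E h₂
  | j + 1 => Lp m ω ℏ (Phi m ω ℏ E h₂ j)

open scoped ContDiff in
/-- Smooth in the first and third variables. -/
def Sm (u : ℝ × ℝ × ℝ → ℂ) : Prop :=
  ∀ b : ℝ, ContDiff ℝ ∞ (fun q : ℝ × ℝ => u (q.1, b, q.2))

lemma Sm.fd {u : ℝ × ℝ × ℝ → ℂ} (h : Sm u) (b : ℝ) (q : ℝ × ℝ) :
    HasFDerivAt (fun q : ℝ × ℝ => u (q.1, b, q.2))
      (fderiv ℝ (fun q : ℝ × ℝ => u (q.1, b, q.2)) q) q :=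
  (((h b).differentiable (by simp)) q).hasFDerivAt

lemma Sm.hd1' {u : ℝ × ℝ × ℝ → ℂ} (h : Sm u) (a b c : ℝ) :
    HasDerivAt (fun t => u (t, b, c))
      (fderiv ℝ (fun q : ℝ × ℝ => u (q.1, b, q.2)) (a, c) (1, 0)) a := by
  have h1 : HasDerivAt (fun t : ℝ => ((t, c) : ℝ × ℝ)) (1, 0) a :=
    (hasDerivAt_id a).prodMk (hasDerivAt_const a c)
  exact HasFDerivAt.comp_hasDerivAt (f := fun t : ℝ => ((t, c) : ℝ × ℝ)) a (h.fd b (a, c)) h1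

lemma Sm.hd3' {u : ℝ × ℝ × ℝ → ℂ} (h : Sm u) (a b c : ℝ) :
    HasDerivAt (fun t => u (a, b, t))
      (fderiv ℝ (fun q : ℝ × ℝ => u (q.1, b, q.2)) (a, c) (0, 1)) c := by
  have h1 : HasDerivAt (fun t : ℝ => ((a, t) : ℝ × ℝ)) (0, 1) c :=
    (hasDerivAt_const c a).prodMk (hasDerivAt_id c)
  exact HasFDerivAt.comp_hasDerivAt (f := fun t : ℝ => ((a, t) : ℝ × ℝ)) c (h.fd b (a, c)) h1

lemma Sm.pd1_eq {u : ℝ × ℝ × ℝ → ℂ} (h : Sm u) (a b c : ℝ) :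
    pd1 u (a, b, c) = fderiv ℝ (fun q : ℝ × ℝ => u (q.1, b, q.2)) (a, c) (1, 0) :=
  (h.hd1' a b c).deriv

lemma Sm.pd3_eq {u : ℝ × ℝ × ℝ → ℂ} (h : Sm u) (a b c : ℝ) :
    pd3 u (a, b, c) = fderiv ℝ (fun q : ℝ × ℝ => u (q.1, b, q.2)) (a, c) (0, 1) :=
  (h.hd3' a b c).deriv

lemma Sm.hd1 {u : ℝ × ℝ × ℝ → ℂ} (h : Sm u) (a b c : ℝ) :
    HasDerivAt (fun t => u (t, b, c)) (pd1 u (a, b, c)) a := by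
  rw [h.pd1_eq]; exact h.hd1' a b c

lemma Sm.hd3 {u : ℝ × ℝ × ℝ → ℂ} (h : Sm u) (a b c : ℝ) :
    HasDerivAt (fun t => u (a, b, t)) (pd3 u (a, b, c)) c := by
  rw [h.pd3_eq]; exact h.hd3' a b c

lemma Sm.pd1 {u : ℝ × ℝ × ℝ → ℂ} (h : Sm u) : Sm (pd1 u) := by
  intro b
  simp only [h.pd1_eq]
  exact ((h b).fderiv_right (m := (⊤ : ℕ∞)) (by simp)).clm_apply contDiff_const

lemma Sm.pd3 {u : ℝ × ℝ × ℝ → ℂ} (h : Sm u) : Sm (pd3 u) := by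
  intro b
  simp only [h.pd3_eq]
  exact ((h b).fderiv_right (m := (⊤ : ℕ∞)) (by simp)).clm_apply contDiff_const

lemma Sm.comm {u : ℝ × ℝ × ℝ → ℂ} (h : Sm u) : _root_.pd3 (_root_.pd1 u) = _root_.pd1 (_root_.pd3 u) := by
  funext ⟨a, b, c⟩
  rw [h.pd1.pd3_eq, h.pd3.pd1_eq]
  simp only [h.pd1_eq, h.pd3_eq]
  have hd : DifferentiableAt ℝ (fderiv ℝ (fun q : ℝ × ℝ => u (q.1, b, q.2))) (a, c) :=
    (((h b).fderiv_right (m := (⊤ : ℕ∞)) (by simp)).differentiable (by simp)) _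
  have key : ∀ v w : ℝ × ℝ,
      fderiv ℝ (fun q : ℝ × ℝ => fderiv ℝ (fun q : ℝ × ℝ => u (q.1, b, q.2)) q v) (a, c) w
      = fderiv ℝ (fderiv ℝ (fun q : ℝ × ℝ => u (q.1, b, q.2))) (a, c) w v := by
    intro v w
    rw [fderiv_clm_apply hd (differentiableAt_const v)]
    simp
  have hs : IsSymmSndFDerivAt ℝ (fun q : ℝ × ℝ => u (q.1, b, q.2)) (a, c) :=
    ((h b).contDiffAt).isSymmSndFDerivAt (by
      simp only [minSmoothness_of_isRCLikeNormedField]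
      exact WithTop.coe_le_coe.2 le_top)
  have k1 := key (1, 0) (0, 1)
  have k2 := key (0, 1) (1, 0)
  simp only [Prod.mk.eta] at k1 k2 ⊢
  rw [k1, k2]
  exact hs _ _

lemma ofReal_hd (c : ℝ) : HasDerivAt (fun t : ℝ => (t : ℂ)) 1 c :=
  Complex.ofRealCLM.hasDerivAt (x := c)

lemma Sm.Lp {u : ℝ × ℝ × ℝ → ℂ} (h : Sm u) (m ω ℏ : ℝ) : Sm (Lp m ω ℏ u) := by
  intro b
  have h1 := h.pd1 b
  have h3 := h.pd3 b
  have h0 := h b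
  have hx : ContDiff ℝ (⊤ : ℕ∞) (fun q : ℝ × ℝ => (q.2 : ℂ)) :=
    Complex.ofRealCLM.contDiff.comp contDiff_snd
  unfold _root_.Lp
  dsimp only
  exact contDiff_const.mul ((h1.neg.sub (contDiff_const.mul h3)).add
    ((contDiff_const.mul hx).mul h0))

lemma pd1_Lp {u : ℝ × ℝ × ℝ → ℂ} (h : Sm u) (m ω ℏ : ℝ) :
    pd1 (Lp m ω ℏ u) = Lp m ω ℏ (pd1 u) := by
  funext ⟨a, b, c⟩
  have := ((((h.pd1.hd1 a b c).neg.sub ((h.pd3.hd1 a b c).const_mul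
    ((b : ℂ) + Complex.I * m * ω))).add ((h.hd1 a b c).const_mul
    (2 * Real.pi * Complex.I * ℏ * c)))).const_mul
    (Complex.I / (2 * Real.sqrt (Real.pi * m * ω * ℏ)))
  refine this.deriv.trans ?_
  simp only [Lp, h.comm]

lemma pd3_Lp {u : ℝ × ℝ × ℝ → ℂ} (h : Sm u) (m ω ℏ : ℝ) :
    pd3 (Lp m ω ℏ u) = fun p => Lp m ω ℏ (pd3 u) p +
      (Complex.I / (2 * Real.sqrt (Real.pi * m * ω * ℏ))) * (2 * Real.pi * Complex.I * ℏ) * u p := by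
  funext ⟨a, b, c⟩
  have := ((((h.pd1.hd3 a b c).neg.sub ((h.pd3.hd3 a b c).const_mul
    ((b : ℂ) + Complex.I * m * ω))).add (((ofReal_hd c).const_mul
    (2 * Real.pi * Complex.I * ℏ)).mul (h.hd3 a b c)))).const_mul
    (Complex.I / (2 * Real.sqrt (Real.pi * m * ω * ℏ)))
  refine this.deriv.trans ?_
  simp only [Lp, h.comm]
  ring

lemma pd1_add {u v : ℝ × ℝ × ℝ → ℂ} (hu : Sm u) (hv : Sm v) (k : ℂ) :
    pd1 (fun p => u p + k * v p) = fun p => pd1 u p + k * pd1 v p := by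
  funext ⟨a, b, c⟩
  exact ((hu.hd1 a b c).add ((hv.hd1 a b c).const_mul k)).deriv

lemma pd3_add {u v : ℝ × ℝ × ℝ → ℂ} (hu : Sm u) (hv : Sm v) (k : ℂ) :
    pd3 (fun p => u p + k * v p) = fun p => pd3 u p + k * pd3 v p := by
  funext ⟨a, b, c⟩
  exact ((hu.hd3 a b c).add ((hv.hd3 a b c).const_mul k)).deriv

lemma pd1_Hop {u : ℝ × ℝ × ℝ → ℂ} (h : Sm u) (m ω ℏ a b c : ℝ) :
    pd1 (Hop m ω ℏ u) (a, b, c) = Hop m ω ℏ (pd1 u) (a, b, c) := by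
  have := ((((((h.pd1.pd1.hd1 a b c).const_mul (-(1 / (4 * Real.pi * m)) : ℂ)).sub
    ((h.pd3.pd3.hd1 a b c).const_mul (((b:ℂ)^2 + m^2 * ω^2) / (4 * Real.pi * m)))).sub
    ((h.pd3.pd1.hd1 a b c).const_mul ((b:ℂ) / (2 * Real.pi * m)))).add
    ((h.pd1.hd1 a b c).const_mul ((Complex.I * ℏ / m) * c))).add
    ((h.pd3.hd1 a b c).const_mul ((Complex.I * ℏ / m) * b * c))).add
    ((h.hd1 a b c).const_mul ((1 / (2 * m)) * (Complex.I * ℏ * b + 2 * Real.pi * ℏ^2 * c^2)))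
  refine this.deriv.trans ?_
  simp only [Hop, h.comm, h.pd3.comm]

lemma pd3_Hop {u : ℝ × ℝ × ℝ → ℂ} (h : Sm u) (m ω ℏ a b c : ℝ) :
    pd3 (Hop m ω ℏ u) (a, b, c) = Hop m ω ℏ (pd3 u) (a, b, c)
      + (Complex.I * ℏ / m) * pd1 u (a, b, c) + (Complex.I * ℏ / m) * b * pd3 u (a, b, c)
      + (1 / (2 * m)) * (4 * Real.pi * ℏ^2 * c) * u (a, b, c) := by
  have := ((((((h.pd1.pd1.hd3 a b c).const_mul (-(1 / (4 * Real.pi * m)) : ℂ)).sub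
    ((h.pd3.pd3.hd3 a b c).const_mul (((b:ℂ)^2 + m^2 * ω^2) / (4 * Real.pi * m)))).sub
    ((h.pd3.pd1.hd3 a b c).const_mul ((b:ℂ) / (2 * Real.pi * m)))).add
    (((ofReal_hd c).const_mul (Complex.I * ℏ / m)).mul (h.pd1.hd3 a b c))).add
    (((ofReal_hd c).const_mul ((Complex.I * ℏ / m) * b)).mul (h.pd3.hd3 a b c))).add
    (((((ofReal_hd c).pow 2).const_mul (2 * Real.pi * (ℏ:ℂ)^2)).const_add
      (Complex.I * ℏ * b)).const_mul (1 / (2 * (m:ℂ))) |>.mul (h.hd3 a b c))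
  refine this.deriv.trans ?_
  simp only [Hop, h.comm, h.pd3.comm, h.pd1.comm]
  simp only [Pi.pow_apply]
  push_cast
  ring

lemma Hop_Lp {u : ℝ × ℝ × ℝ → ℂ} (h : Sm u) (m ω ℏ : ℝ) (hm : m ≠ 0) (a b c : ℝ) :
    Hop m ω ℏ (Lp m ω ℏ u) (a, b, c) =
      Lp m ω ℏ (Hop m ω ℏ u) (a, b, c) + ℏ * ω * Lp m ω ℏ u (a, b, c) := by
  have hm' : (m : ℂ) ≠ 0 := by exact_mod_cast hm
  have hpi : (Real.pi : ℂ) ≠ 0 := by exact_mod_cast Real.pi_ne_zero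
  have e11 : pd1 (pd1 (Lp m ω ℏ u)) = Lp m ω ℏ (pd1 (pd1 u)) := by
    rw [pd1_Lp h, pd1_Lp h.pd1]
  have e13 := pd3_Lp h m ω ℏ
  have e33 := congrArg pd3 e13
  rw [pd3_add (h.pd3.Lp m ω ℏ) h, pd3_Lp h.pd3] at e33
  have e31 := congrArg pd1 e13
  rw [pd1_add (h.pd3.Lp m ω ℏ) h, pd1_Lp h.pd3] at e31
  have r : Lp m ω ℏ (Hop m ω ℏ u) (a, b, c) = (Complex.I / (2 * Real.sqrt (Real.pi * m * ω * ℏ))) *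
    (-pd1 (Hop m ω ℏ u) (a, b, c) - (b + Complex.I * m * ω) * pd3 (Hop m ω ℏ u) (a, b, c)
      + 2 * Real.pi * Complex.I * ℏ * c * Hop m ω ℏ u (a, b, c)) := rfl
  rw [r, pd1_Hop h, pd3_Hop h]
  unfold Hop
  rw [e11, e33, e31, e13, pd1_Lp h]
  simp only [Lp, h.comm, h.pd3.comm, h.pd1.comm]
  generalize Complex.I / (2 * (Real.sqrt (Real.pi * m * ω * ℏ) : ℂ)) = k
  field_simp
  ring_nf
  simp only [Complex.I_sq, show Complex.I ^ 3 = -Complex.I from Complex.I_pow_three]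
  ring

lemma Phi0_Sm (m ω ℏ E h₂ : ℝ) : Sm (Phi0 m ω ℏ E h₂) := by
  intro b
  have hx : ContDiff ℝ (⊤ : ℕ∞) (fun q : ℝ × ℝ => (q.1 : ℂ)) :=
    Complex.ofRealCLM.contDiff.comp contDiff_fst
  have hy : ContDiff ℝ (⊤ : ℕ∞) (fun q : ℝ × ℝ => (q.2 : ℂ)) :=
    Complex.ofRealCLM.contDiff.comp contDiff_snd
  unfold Phi0
  simp only [div_eq_mul_inv]
  exact contDiff_const.mul (ContDiff.cexp (((contDiff_const.mul (hx.pow 2)).neg.sub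
    contDiff_const).sub ((contDiff_const.mul ((hy.sub (contDiff_const.mul hx)).pow 2)).mul
      contDiff_const)))

lemma pd1_Phi0 (m ω ℏ E h₂ : ℝ) : pd1 (Phi0 m ω ℏ E h₂) = fun p =>
    (-(2 * Real.pi * ℏ * E * p.1) + 2 * Real.pi * ℏ * Complex.I * E *
      (p.2.2 - Complex.I * E * p.1) * (Complex.I * p.2.1 + E + m * ω)⁻¹) * Phi0 m ω ℏ E h₂ p := by
  funext ⟨a, b, c⟩
  have hx := ofReal_hd a
  have := ((((((hx.pow 2).const_mul (Real.pi * ℏ * E : ℂ)).neg.sub_const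
    (2 * Real.pi * Complex.I * h₂ * b)).sub (((((hx.const_mul (Complex.I * E)).const_sub
      (c:ℂ)).pow 2).const_mul (Real.pi * ℏ : ℂ)).div_const (Complex.I * b + E + m * ω)))).cexp).const_mul
    ((Real.sqrt 2 : ℂ) * ((m * ω * E : ℝ) ^ ((1:ℝ)/4) : ℝ) *
    (Complex.I * b + E + m * ω) ^ (-(1/2) : ℂ))
  refine this.deriv.trans ?_
  simp only [Phi0, div_eq_mul_inv, Pi.pow_apply, Pi.sub_apply, Pi.neg_apply]
  push_cast
  ring

lemma pd3_Phi0 (m ω ℏ E h₂ : ℝ) : pd3 (Phi0 m ω ℏ E h₂) = fun p =>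
    (-(2 * Real.pi * ℏ *
      (p.2.2 - Complex.I * E * p.1) * (Complex.I * p.2.1 + E + m * ω)⁻¹)) * Phi0 m ω ℏ E h₂ p := by
  funext ⟨a, b, c⟩
  have hx := ofReal_hd c
  have := ((((((hx.sub_const (Complex.I * E * a)).pow 2).const_mul (Real.pi * ℏ : ℂ)).div_const
    (Complex.I * b + E + m * ω)).const_sub (-(Real.pi * ℏ * E * (a:ℂ)^2)
      - 2 * Real.pi * Complex.I * h₂ * b)).cexp).const_mul
    ((Real.sqrt 2 : ℂ) * ((m * ω * E : ℝ) ^ ((1:ℝ)/4) : ℝ) *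
    (Complex.I * b + E + m * ω) ^ (-(1/2) : ℂ))
  refine this.deriv.trans ?_
  simp only [Phi0, div_eq_mul_inv, Pi.pow_apply, Pi.sub_apply, Pi.neg_apply]
  push_cast
  ring

lemma Hop_Phi0 (m ω ℏ E h₂ : ℝ) (hm : 0 < m) (hω : 0 < ω) (hE : 0 < E) (a b c : ℝ) :
    Hop m ω ℏ (Phi0 m ω ℏ E h₂) (a, b, c) = ℏ * ω * (1/2) * Phi0 m ω ℏ E h₂ (a, b, c) := by
  have hS := Phi0_Sm m ω ℏ E h₂
  have hm' : (m : ℂ) ≠ 0 := by exact_mod_cast hm.ne'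
  have hpi : (Real.pi : ℂ) ≠ 0 := by exact_mod_cast Real.pi_ne_zero
  have hs : (Complex.I * b + E + m * ω : ℂ) ≠ 0 := by
    intro h0
    have := congrArg Complex.re h0
    simp at this
    nlinarith [mul_pos hm hω]
  have e1 := congrFun (pd1_Phi0 m ω ℏ E h₂) (a, b, c)
  have e3 := congrFun (pd3_Phi0 m ω ℏ E h₂) (a, b, c)
  have e11 := (congrFun (congrArg pd1 (pd1_Phi0 m ω ℏ E h₂)) (a, b, c)).trans
    (HasDerivAt.mul (((ofReal_hd a).const_mul (2 * Real.pi * ℏ * E : ℂ)).neg.add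
      ((((ofReal_hd a).const_mul (Complex.I * E)).const_sub (c:ℂ)).const_mul
        (2 * Real.pi * ℏ * Complex.I * E) |>.mul_const (Complex.I * b + E + m * ω)⁻¹))
      (hS.hd1 a b c)).deriv
  have e31 := (congrFun (congrArg pd1 (pd3_Phi0 m ω ℏ E h₂)) (a, b, c)).trans
    (HasDerivAt.mul (
      ((((ofReal_hd a).const_mul (Complex.I * E)).const_sub (c:ℂ)).const_mul
        (2 * Real.pi * ℏ : ℂ) |>.mul_const (Complex.I * b + E + m * ω)⁻¹).neg)
      (hS.hd1 a b c)).deriv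
  have e33 := (congrFun (congrArg pd3 (pd3_Phi0 m ω ℏ E h₂)) (a, b, c)).trans
    (HasDerivAt.mul (
      (((ofReal_hd c).sub_const (Complex.I * E * a)).const_mul
        (2 * Real.pi * ℏ : ℂ) |>.mul_const (Complex.I * b + E + m * ω)⁻¹).neg)
      (hS.hd3 a b c)).deriv
  unfold Hop
  rw [e11, e31, e33, e1, e3]
  simp only [Pi.add_apply, Pi.neg_apply]
  generalize Phi0 m ω ℏ E h₂ (a, b, c) = F
  have hb : (b : ℂ) = -Complex.I * ((Complex.I * b + E + m * ω) - E - m * ω) := by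
    ring_nf
    simp
  generalize (Complex.I * b + E + m * ω : ℂ) = s at hs hb ⊢
  rw [hb]
  field_simp
  ring_nf
  have i4 : Complex.I ^ 4 = 1 := Complex.I_pow_four
  have i3 : Complex.I ^ 3 = -Complex.I := Complex.I_pow_three
  have i5 : Complex.I ^ 5 = Complex.I := by rw [pow_succ, i4, one_mul]
  have i6 : Complex.I ^ 6 = -1 := by rw [pow_succ, i5, Complex.I_mul_I]
  simp only [Complex.I_sq, i3, i4, i5, i6]
  ring

lemma Phi_Sm (m ω ℏ E h₂ : ℝ) (j : ℕ) : Sm (Phi m ω ℏ E h₂ j) := by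
  induction j with
  | zero => exact Phi0_Sm m ω ℏ E h₂
  | succ j ih => exact ih.Lp m ω ℏ

lemma Lp_smul {u : ℝ × ℝ × ℝ → ℂ} (h : Sm u) (m ω ℏ : ℝ) (k : ℂ) (a b c : ℝ) :
    Lp m ω ℏ (fun p => k * u p) (a, b, c) = k * Lp m ω ℏ u (a, b, c) := by
  have h1 : pd1 (fun p => k * u p) (a, b, c) = _ := ((h.hd1 a b c).const_mul k).deriv
  have h3 : pd3 (fun p => k * u p) (a, b, c) = _ := ((h.hd3 a b c).const_mul k).deriv
  simp only [Lp, h1, h3]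
  ring

theorem stmt18 (m ω ℏ E h₂ : ℝ) (hm : 0 < m) (hω : 0 < ω) (hℏ : 0 < ℏ) (hE : 0 < E) :
    ∀ (j : ℕ) (p : ℝ × ℝ × ℝ),
      Hop m ω ℏ (Phi m ω ℏ E h₂ j) p
        = ℏ * ω * ((j : ℂ) + 1/2) * Phi m ω ℏ E h₂ j p := by
  intro j
  induction j with
  | zero =>
    rintro ⟨a, b, c⟩
    simpa [Phi] using Hop_Phi0 m ω ℏ E h₂ hm hω hE a b c
  | succ j ih =>
    rintro ⟨a, b, c⟩
    have hS := Phi_Sm m ω ℏ E h₂ j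
    have := Hop_Lp hS m ω ℏ hm.ne' a b c
    rw [funext ih, Lp_smul hS] at this
    refine this.trans ?_
    simp only [Phi]
    push_cast
    ring
end
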